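/- Fix a data index set ι (finite), a type Z, kernel functions k_α : Z × Z → ℝ and k_{β,l} : Z × Z → ℝ for l = 1, …, m, data points z_i ∈ Z and u_i ∈ ℝ^m for i ∈ ι, targets ŷ ∈ ℝ^ι, and an invertible matrix K ∈ ℝ^{ι×ι}. For a query point (z, u) ∈ Z × ℝ^m define the vector k(z,u) ∈ ℝ^ι by k(z,u)_i = k_α(z, z_i) + Σ_{l=1}^m u(l) k_{β,l}(z, z_i) u_i(l), the posterior mean μ(z,u) = k(z,u)ᵀ K⁻¹ ŷ, and the posterior variance σ²(z,u) = k_α(z,z) + Σ_{l=1}^m u(l)² k_{β,l}(z,z) − k(z,u)ᵀ K⁻¹ k(z,u). Then for every fixed z ∈ Z there exist γ₁ ∈ ℝ, γ₂ ∈ ℝ^m, γ₃ ∈ ℝ, γ₄ ∈ ℝ^m and a matrix γ₅ ∈ ℝ^{m×m} such that for all u ∈ ℝ^m: μ(z,u) = γ₁ + γ₂ᵀ u and σ²(z,u) = γ₃ + γ₄ᵀ u + uᵀ γ₅ u. -/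

import Mathlib

open Matrix

/-- Pairing an affine function of `u` with a fixed vector is affine in `u`. -/
theorem Matrix.add_mulVec_dotProduct {ι κ R : Type*} [Fintype ι] [Fintype κ] [CommRing R]
    (a w : ι → R) (B : Matrix ι κ R) (u : κ → R) :
    (a + B *ᵥ u) ⬝ᵥ w = a ⬝ᵥ w + (Bᵀ *ᵥ w) ⬝ᵥ u := by
  rw [add_dotProduct, dotProduct_comm (B *ᵥ u), dotProduct_mulVec, mulVec_transpose]

/-- A quadratic form evaluated at an affine function of `u` is quadratic in `u`. -/
theorem Matrix.add_mulVec_dotProduct_mulVec {ι κ R : Type*} [Fintype ι] [Fintype κ] [CommRing R]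
    (a : ι → R) (M : Matrix ι ι R) (B : Matrix ι κ R) (u : κ → R) :
    (a + B *ᵥ u) ⬝ᵥ M *ᵥ (a + B *ᵥ u) =
      a ⬝ᵥ M *ᵥ a + (Bᵀ *ᵥ M *ᵥ a + Bᵀ *ᵥ Mᵀ *ᵥ a) ⬝ᵥ u + u ⬝ᵥ (Bᵀ * M * B) *ᵥ u := by
  have hcross : a ⬝ᵥ M *ᵥ B *ᵥ u = (Bᵀ *ᵥ Mᵀ *ᵥ a) ⬝ᵥ u := by
    rw [dotProduct_mulVec, dotProduct_mulVec, mulVec_transpose, mulVec_transpose]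
  rw [add_mulVec_dotProduct, mulVec_add, mulVec_add, dotProduct_add, add_dotProduct,
    add_dotProduct, hcross, dotProduct_comm (Bᵀ *ᵥ M *ᵥ B *ᵥ u), mulVec_mulVec, mulVec_mulVec,
    mulVec_mulVec, mulVec_mulVec]
  ring

/-- Equations (10)–(11): with the affine kernel, the GP posterior mean is affine
in the extended input `u` and the posterior variance is quadratic in `u`. -/
theorem gp_posterior_affine_quadratic
    {ι : Type*} [Fintype ι] [DecidableEq ι] {Z : Type*}
    (m : ℕ)
    (kα : Z → Z → ℝ) (kβ : Fin m → Z → Z → ℝ)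
    (zdata : ι → Z) (udata : ι → Fin m → ℝ)
    (yhat : ι → ℝ)
    (K : Matrix ι ι ℝ) (hK : IsUnit K.det)
    (kvec : Z → (Fin m → ℝ) → ι → ℝ)
    (hkvec : ∀ z u i, kvec z u i =
      kα z (zdata i) + ∑ l, u l * kβ l z (zdata i) * udata i l)
    (mean : Z → (Fin m → ℝ) → ℝ)
    (hmean : ∀ z u, mean z u = kvec z u ⬝ᵥ (K⁻¹).mulVec yhat)
    (var : Z → (Fin m → ℝ) → ℝ)
    (hvar : ∀ z u, var z u =
      kα z z + ∑ l, (u l) ^ 2 * kβ l z z - kvec z u ⬝ᵥ (K⁻¹).mulVec (kvec z u)) :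
    ∀ z : Z, ∃ (γ₁ : ℝ) (γ₂ : Fin m → ℝ) (γ₃ : ℝ) (γ₄ : Fin m → ℝ)
      (γ₅ : Matrix (Fin m) (Fin m) ℝ),
      ∀ u : Fin m → ℝ,
        mean z u = γ₁ + γ₂ ⬝ᵥ u ∧
        var z u = γ₃ + γ₄ ⬝ᵥ u + u ⬝ᵥ γ₅.mulVec u := by
  intro z
  let a : ι → ℝ := fun i => kα z (zdata i)
  let B : Matrix ι (Fin m) ℝ := of fun i l => kβ l z (zdata i) * udata i l
  let D : Matrix (Fin m) (Fin m) ℝ := diagonal fun l => kβ l z z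
  have hk : ∀ u, kvec z u = a + B *ᵥ u := by
    intro u
    ext i
    simp only [hkvec, a, B, Pi.add_apply, mulVec, dotProduct, of_apply]
    congr 1
    exact Finset.sum_congr rfl fun l _ => by ring
  have hD : ∀ u : Fin m → ℝ, ∑ l, (u l) ^ 2 * kβ l z z = u ⬝ᵥ D *ᵥ u := by
    intro u
    simp only [D, dotProduct, mulVec_diagonal]
    exact Finset.sum_congr rfl fun l _ => by ring
  refine ⟨a ⬝ᵥ K⁻¹ *ᵥ yhat, Bᵀ *ᵥ K⁻¹ *ᵥ yhat, kα z z - a ⬝ᵥ K⁻¹ *ᵥ a,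
    -(Bᵀ *ᵥ K⁻¹ *ᵥ a + Bᵀ *ᵥ (K⁻¹)ᵀ *ᵥ a), D - Bᵀ * K⁻¹ * B, fun u => ⟨?_, ?_⟩⟩
  · rw [hmean, hk, add_mulVec_dotProduct]
  · rw [hvar, hk, hD, add_mulVec_dotProduct_mulVec, neg_dotProduct, sub_mulVec, dotProduct_sub]
    ring
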